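/- Let F and G be symmetrically equivalent n-linear forms (n ≥ 2) on finite-dimensional real vector spaces U and V, and let F = F₁ ⊕ ⋯ ⊕ F_s ⊕ 0 and G = G₁ ⊕ ⋯ ⊕ G_r ⊕ 0 be decompositions in which all the summands F_i and G_j are nonzero and indecomposable. Then s = r and, after a suitable reindexing of the summands, each F_i is congruent to G_i or to −G_i. -/

import Mathlib

section Defs

variable {K : Type*} [Field K] {n : ℕ}

/-- The restriction of a multilinear form to a submodule. -/
def formRestrict {U : Type*} [AddCommGroup U] [Module K U]
    (F : MultilinearMap K (fun _ : Fin n => U) K) (W : Submodule K U) :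
    MultilinearMap K (fun _ : Fin n => W) K :=
  F.compLinearMap fun _ => W.subtype

/-- Two multilinear forms are congruent if a single linear bijection carries one to the other. -/
def FormCongruent {U V : Type*} [AddCommGroup U] [Module K U] [AddCommGroup V] [Module K V]
    (F : MultilinearMap K (fun _ : Fin n => U) K)
    (G : MultilinearMap K (fun _ : Fin n => V) K) : Prop :=
  ∃ φ : U ≃ₗ[K] V, ∀ u : Fin n → U, F u = G fun i => φ (u i)

/-- Symmetric equivalence of multilinear forms. -/
def FormSymmEquiv {U V : Type*} [AddCommGroup U] [Module K U] [AddCommGroup V] [Module K V]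
    (F : MultilinearMap K (fun _ : Fin n => U) K)
    (G : MultilinearMap K (fun _ : Fin n => V) K) : Prop :=
  ∃ φ : Fin n → U ≃ₗ[K] V, ∀ (σ : Equiv.Perm (Fin n)) (u : Fin n → U),
    F u = G fun i => φ (σ i) (u i)

/-- `W` is a direct-sum decomposition of the underlying space for which `F` vanishes on
mixed tuples, i.e. `F = ⨁ᵢ F|Wᵢ`. -/
def IsDecompFamily {U : Type*} [AddCommGroup U] [Module K U] {ι : Type*} [DecidableEq ι]
    (F : MultilinearMap K (fun _ : Fin n => U) K) (W : ι → Submodule K U) : Prop :=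
  DirectSum.IsInternal W ∧
    ∀ (x : Fin n → U) (k l : Fin n) (i j : ι), i ≠ j → x k ∈ W i → x l ∈ W j → F x = 0

/-- A multilinear form is indecomposable if in every direct-sum decomposition one of the
two subspaces is zero. -/
def FormIndecomposable {U : Type*} [AddCommGroup U] [Module K U]
    (F : MultilinearMap K (fun _ : Fin n => U) K) : Prop :=
  ∀ W₁ W₂ : Submodule K U, IsCompl W₁ W₂ →
    (∀ (x : Fin n → U) (k l : Fin n), x k ∈ W₁ → x l ∈ W₂ → F x = 0) →
    W₁ = ⊥ ∨ W₂ = ⊥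

/-- A multilinear form has no zero direct summands if in every direct-sum decomposition the
summand that is the zero form corresponds to the zero subspace. -/
def FormNoZeroSummand {U : Type*} [AddCommGroup U] [Module K U]
    (F : MultilinearMap K (fun _ : Fin n => U) K) : Prop :=
  ∀ W₁ W₂ : Submodule K U, IsCompl W₁ W₂ →
    (∀ (x : Fin n → U) (k l : Fin n), x k ∈ W₁ → x l ∈ W₂ → F x = 0) →
    (∀ x : Fin n → U, (∀ k, x k ∈ W₂) → F x = 0) → W₂ = ⊥

/-- A linear map `τ` is `G`-selfadjoint if applying `τ` in any one argument of `G`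
gives the same value regardless of the argument chosen. -/
def FormSelfAdjoint {V : Type*} [AddCommGroup V] [Module K V]
    (G : MultilinearMap K (fun _ : Fin n => V) K) (τ : V →ₗ[K] V) : Prop :=
  ∀ (v : Fin n → V) (i j : Fin n),
    G (Function.update v i (τ (v i))) = G (Function.update v j (τ (v j)))

end Defs

section

open Function Polynomial

/-- Up to sign, every complex number has an `m`-th root that is a real polynomial in it. -/
theorem exists_real_poly_pow_root (z : ℂ) {m : ℕ} (hm : m ≠ 0) :
    ∃ q : ℝ[X], ∃ ε : ℝ, (ε = 1 ∨ ε = -1) ∧ aeval z (q ^ m - C ε * X) = 0 := by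
  by_cases hz : z.im = 0
  · obtain ⟨a, rfl⟩ : ∃ a : ℝ, z = a := ⟨z.re, by apply Complex.ext <;> simp [hz]⟩
    rcases le_total 0 a with ha | ha
    · refine ⟨C (a ^ ((m : ℝ)⁻¹)), 1, Or.inl rfl, ?_⟩
      have := Real.rpow_inv_natCast_pow ha hm
      simp [← Complex.ofReal_pow, this]
    · refine ⟨C ((-a) ^ ((m : ℝ)⁻¹)), -1, Or.inr rfl, ?_⟩
      have := Real.rpow_inv_natCast_pow (neg_nonneg.2 ha) hm
      simp [← Complex.ofReal_pow, this]
  · obtain ⟨w, hw⟩ := IsAlgClosed.exists_pow_nat_eq z (Nat.pos_of_ne_zero hm)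
    refine ⟨C (w.re - w.im / z.im * z.re) + C (w.im / z.im) * X, 1, Or.inl rfl, ?_⟩
    have : aeval z (C (w.re - w.im / z.im * z.re) + C (w.im / z.im) * X : ℝ[X]) = w := by
      apply Complex.ext <;> simp [field]
    rw [map_sub, map_pow, this, hw]
    simp

theorem Irreducible.exists_pow_dvd_pow_sub {p : ℝ[X]} (hp : Irreducible p) (hX : IsCoprime p X)
    (k : ℕ) {m : ℕ} (hm : m ≠ 0) :
    ∃ q : ℝ[X], ∃ ε : ℝ, (ε = 1 ∨ ε = -1) ∧ p ^ k ∣ q ^ m - C ε * X := by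
  obtain ⟨z, hz⟩ := IsAlgClosed.exists_aeval_eq_zero ℂ p hp.degree_pos.ne'
  obtain ⟨q, ε, hε, hq⟩ := exists_real_poly_pow_root z hm
  have hpq : p ∣ q ^ m - C ε * X :=
    (((minpoly.irreducible (Algebra.IsIntegral.isIntegral z)).associated_of_dvd hp
      (minpoly.dvd ℝ z hz)).dvd_iff_dvd_left).1 (minpoly.dvd ℝ z hq)
  let π := Ideal.Quotient.mk (Ideal.span {p ^ k})
  have hnil : IsNilpotent (π q ^ m - π (C ε * X)) := by
    refine ⟨k, ?_⟩
    rw [← map_pow, ← map_sub, ← map_pow, Ideal.Quotient.eq_zero_iff_dvd]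
    exact pow_dvd_pow_of_dvd hpq k
  have hXu : IsUnit (π (C ε * X)) := by
    rw [map_mul]
    refine IsUnit.mul ((isUnit_C.2 ?_).map π) ?_
    · rcases hε with rfl | rfl <;> simp
    · obtain ⟨a, b, hab⟩ := hX.pow_left (m := k)
      refine IsUnit.of_mul_eq_one (π b) ?_
      rw [← map_mul, ← map_one π, Ideal.Quotient.eq, Ideal.mem_span_singleton]
      exact ⟨-a, by linear_combination hab⟩
  have hqu : IsUnit (π q) := by
    rw [← isUnit_pow_iff hm]
    have := hnil.isUnit_add_left_of_commute hXu (Commute.all _ _)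
    simpa using this
  obtain ⟨r, ⟨-, hr⟩, -⟩ := Polynomial.existsUnique_nilpotent_sub_and_aeval_eq_zero
    (P := (X ^ m - C (π (C ε * X)) : (ℝ[X] ⧸ Ideal.span {p ^ k})[X])) (x := π q)
    (by simpa using hnil) (by
      have : IsUnit (m : ℝ[X] ⧸ Ideal.span {p ^ k}) := by
        have := (isUnit_iff_ne_zero.2 (Nat.cast_ne_zero (R := ℝ).2 hm)).map
          (algebraMap ℝ (ℝ[X] ⧸ Ideal.span {p ^ k}))
        simpa using this
      rw [derivative_sub, derivative_C, sub_zero, derivative_X_pow]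
      simpa using this.mul (hqu.pow (m - 1)))
  obtain ⟨q', rfl⟩ := Ideal.Quotient.mk_surjective r
  refine ⟨q', ε, hε, ?_⟩
  rw [← Ideal.Quotient.eq_zero_iff_dvd]
  simpa using hr

section SelfAdjoint

variable {K : Type*} [Field K] {n : ℕ} {V : Type*} [AddCommGroup V] [Module K V]
  {G : MultilinearMap K (fun _ : Fin n => V) K}

theorem FormSelfAdjoint.of_ne {τ : V →ₗ[K] V}
    (h : ∀ (v : Fin n → V) (i j : Fin n), i ≠ j →
      G (update v i (τ (v i))) = G (update v j (τ (v j)))) : FormSelfAdjoint G τ := by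
  intro v i j
  rcases eq_or_ne i j with rfl | hij
  · rfl
  · exact h v i j hij

theorem formSelfAdjoint_one : FormSelfAdjoint G 1 := by
  intro v i j
  simp

theorem FormSelfAdjoint.add {τ σ : V →ₗ[K] V} (hτ : FormSelfAdjoint G τ)
    (hσ : FormSelfAdjoint G σ) : FormSelfAdjoint G (τ + σ) := by
  intro v i j
  simp only [LinearMap.add_apply, MultilinearMap.map_update_add]
  rw [hτ v i j, hσ v i j]

theorem FormSelfAdjoint.smul {τ : V →ₗ[K] V} (hτ : FormSelfAdjoint G τ) (c : K) :
    FormSelfAdjoint G (c • τ) := by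
  intro v i j
  simp only [LinearMap.smul_apply, MultilinearMap.map_update_smul]
  rw [hτ v i j]

/-- Moving one selfadjoint operator past another one that acts in a different slot. -/
theorem FormSelfAdjoint.update_mul_apply {τ σ : V →ₗ[K] V} (hτ : FormSelfAdjoint G τ)
    (hσ : FormSelfAdjoint G σ) (v : Fin n → V) {i j : Fin n} (hij : i ≠ j) :
    G (update v i ((τ * σ) (v i))) = G (update v j ((σ * τ) (v j))) := by
  have h1 := hτ (update v i (σ (v i))) i j
  have h2 := hσ (update v j (τ (v j))) i j
  simp only [update_self, update_idem, update_of_ne hij, update_of_ne hij.symm] at h1 h2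
  rw [Module.End.mul_apply, h1, update_comm hij, h2, Module.End.mul_apply]

theorem FormSelfAdjoint.mul {τ σ : V →ₗ[K] V} (hτ : FormSelfAdjoint G τ)
    (hσ : FormSelfAdjoint G σ) (hc : Commute τ σ) : FormSelfAdjoint G (τ * σ) :=
  .of_ne fun v i j hij => by rw [hτ.update_mul_apply hσ v hij, hc.eq]

theorem FormSelfAdjoint.aeval {τ : V →ₗ[K] V} (hτ : FormSelfAdjoint G τ) (p : K[X]) :
    FormSelfAdjoint G (aeval τ p) := by
  induction p using Polynomial.induction_on with
  | C a => simpa [Algebra.algebraMap_eq_smul_one] using formSelfAdjoint_one.smul a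
  | add p q hp hq => simpa using hp.add hq
  | monomial k a ih =>
    have := ih.mul hτ (by
      have h := (Commute.all (C a * X ^ k) X).map (Polynomial.aeval (R := K) τ)
      rwa [aeval_X] at h)
    simpa [pow_succ, mul_assoc] using this

/-- Selfadjoint operators commute up to the radical as soon as there are three slots. -/
theorem FormSelfAdjoint.update_mul_comm_apply {τ σ : V →ₗ[K] V} (hn : 3 ≤ n)
    (hτ : FormSelfAdjoint G τ) (hσ : FormSelfAdjoint G σ) (v : Fin n → V) (i : Fin n) :
    G (update v i ((τ * σ) (v i))) = G (update v i ((σ * τ) (v i))) := by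
  obtain ⟨b, hb, -⟩ := Fin.exists_ne_and_ne_of_two_lt i i hn
  obtain ⟨c, hci, hcb⟩ := Fin.exists_ne_and_ne_of_two_lt i b hn
  rw [hτ.update_mul_apply hσ v hb.symm, hσ.update_mul_apply hτ v hcb.symm,
    hτ.update_mul_apply hσ v hci]

/-- The product of operators over distinct labels, where slot `i` carries the operator labelled
`σ i`, can be collected in a single slot `j`. -/
theorem FormSelfAdjoint.apply_collect {τ : Fin n → V →ₗ[K] V}
    (hτ : ∀ k, FormSelfAdjoint G (τ k)) (σ : Equiv.Perm (Fin n)) (j : Fin n)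
    (hc : ∀ l, Commute (τ (σ j)) (τ l)) (L : List (Fin n)) (hL : L.Nodup) (v : Fin n → V) :
    G (fun i => if σ i ∈ L then τ (σ i) (v i) else v i) =
      G (update v j ((L.map τ).prod (v j))) := by
  induction L generalizing v with
  | nil => simp
  | cons k L ih =>
    obtain ⟨i, rfl⟩ := σ.surjective k
    obtain ⟨hk, hL'⟩ := List.nodup_cons.1 hL
    have h1 := ih hL' (update v i (τ (σ i) (v i)))
    have h2 : (fun l => if σ l ∈ σ i :: L then τ (σ l) (v l) else v l) =
        fun l => if σ l ∈ L then τ (σ l) (update v i (τ (σ i) (v i)) l)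
          else update v i (τ (σ i) (v i)) l := by
      funext l
      rcases eq_or_ne l i with rfl | hl
      · simp [hk]
      · simp [hl]
    rw [h2, h1, List.map_cons, List.prod_cons]
    rcases eq_or_ne i j with rfl | hij
    · have hcomm : Commute (τ (σ i)) (L.map τ).prod := by
        refine Commute.list_prod_right _ _ fun x hx => ?_
        obtain ⟨l, -, rfl⟩ := List.mem_map.1 hx
        exact hc l
      simp only [update_self, update_idem]
      rw [hcomm.eq, Module.End.mul_apply]
    · have h3 := hτ (σ i) (update v j ((L.map τ).prod (v j))) i j
      simp only [update_self, update_idem, update_of_ne hij, update_of_ne hij.symm] at h3 ⊢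
      rw [update_comm hij, h3, Module.End.mul_apply]

theorem FormSelfAdjoint.apply_comp_eq_pow {ρ : V →ₗ[K] V} (hρ : FormSelfAdjoint G ρ)
    (v : Fin n → V) (j : Fin n) :
    G (fun i => ρ (v i)) = G (update v j ((ρ ^ n) (v j))) := by
  simpa [List.map_const'] using FormSelfAdjoint.apply_collect (τ := fun _ => ρ) (fun _ => hρ) 1 j
    (fun _ => Commute.refl _) (List.finRange n) (List.nodup_finRange n) v

/-- Kernels of coprime polynomials in a selfadjoint operator are orthogonal. -/
theorem FormSelfAdjoint.apply_eq_zero_of_isCoprime {τ : V →ₗ[K] V} (hτ : FormSelfAdjoint G τ)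
    {a b : K[X]} (hab : IsCoprime a b) (x : Fin n → V) {k l : Fin n}
    (hk : Polynomial.aeval τ a (x k) = 0) (hl : Polynomial.aeval τ b (x l) = 0) : G x = 0 := by
  obtain ⟨u, w, huw⟩ := hab
  have h1 : x k = Polynomial.aeval τ b (Polynomial.aeval τ w (x k)) := by
    have := congrArg (fun p => Polynomial.aeval τ p (x k)) huw
    simp only [map_add, map_mul, map_one, LinearMap.add_apply, Module.End.mul_apply, hk, map_zero,
      zero_add, Module.End.one_apply] at this
    rw [← Module.End.mul_apply, ← map_mul, mul_comm b w, map_mul, Module.End.mul_apply, this]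
  rcases eq_or_ne k l with rfl | hkl
  · refine G.map_coord_zero k ?_
    rw [h1, ← Module.End.mul_apply, ← map_mul, mul_comm, map_mul, Module.End.mul_apply, hl,
      map_zero]
  · have h2 := hτ.aeval b (update x k (Polynomial.aeval τ w (x k))) k l
    simp only [update_self, update_idem, update_of_ne hkl.symm, hl] at h2
    rw [← h1, update_eq_self] at h2
    rw [h2]
    exact G.map_coord_zero l (by simp)

theorem FormIndecomposable.ker_eq_bot_or_of_isCoprime (hG : FormIndecomposable G)
    {τ : V →ₗ[K] V} (hτ : FormSelfAdjoint G τ) {a b : K[X]} (hab : IsCoprime a b)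
    (h0 : Polynomial.aeval τ (a * b) = 0) :
    Polynomial.aeval τ a = 0 ∨ Polynomial.aeval τ b = 0 := by
  have hsup := sup_ker_aeval_eq_ker_aeval_mul_of_coprime τ hab
  rw [h0, LinearMap.ker_zero] at hsup
  rcases hG _ _ ⟨disjoint_ker_aeval_of_isCoprime τ hab, codisjoint_iff.2 hsup⟩
    (fun x k l hk hl => hτ.apply_eq_zero_of_isCoprime hab x hk hl) with h | h
  · right
    rwa [h, bot_sup_eq, LinearMap.ker_eq_top] at hsup
  · left
    rwa [h, sup_bot_eq, LinearMap.ker_eq_top] at hsup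

theorem FormIndecomposable.exists_irreducible_pow [FiniteDimensional K V] [Nontrivial V]
    (hG : FormIndecomposable G) {τ : V →ₗ[K] V} (hτ : FormSelfAdjoint G τ) :
    ∃ p : K[X], Irreducible p ∧ ∃ k : ℕ, Polynomial.aeval τ (p ^ k) = 0 := by
  have h_integral := Algebra.IsIntegral.isIntegral (R := K) τ
  have hne := minpoly.ne_zero h_integral
  obtain ⟨p, hp, hdvd⟩ := WfDvdMonoid.exists_irreducible_factor (minpoly.not_isUnit K τ) hne
  have hfin := FiniteMultiplicity.of_not_isUnit hp.not_isUnit hne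
  obtain ⟨b, hb, hpb⟩ := hfin.exists_eq_pow_mul_and_not_dvd
  have hcop : IsCoprime (p ^ multiplicity p (minpoly K τ)) b :=
    (hp.coprime_iff_not_dvd.2 hpb).pow_left
  refine ⟨p, hp, ?_⟩
  rcases hG.ker_eq_bot_or_of_isCoprime hτ hcop (by rw [← hb, minpoly.aeval]) with h | h
  · exact ⟨_, h⟩
  · have hd := minpoly.dvd K τ h
    exact absurd (hdvd.trans hd) hpb

/-- Fitting's lemma for selfadjoint operators of an indecomposable form. -/
theorem FormIndecomposable.isNilpotent_or_isUnit [FiniteDimensional K V] [Nontrivial V]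
    (hG : FormIndecomposable G) {τ : V →ₗ[K] V} (hτ : FormSelfAdjoint G τ) :
    IsNilpotent τ ∨ IsUnit τ := by
  obtain ⟨p, hp, k, hk⟩ := hG.exists_irreducible_pow hτ
  by_cases hX : p ∣ X
  · left
    refine ⟨k, ?_⟩
    obtain ⟨q, hq⟩ := pow_dvd_pow_of_dvd hX k
    have := congrArg (Polynomial.aeval τ) hq
    rwa [map_mul, hk, zero_mul, map_pow, aeval_X] at this
  · right
    obtain ⟨u, w, h⟩ := (hp.coprime_iff_not_dvd.2 hX).pow_left (m := k)
    have := congrArg (Polynomial.aeval τ) h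
    rw [map_add, map_mul, hk, mul_zero, zero_add, map_mul, aeval_X, map_one] at this
    exact IsUnit.of_mul_eq_one_right _ this

end SelfAdjoint

/-- A selfadjoint unit of a real indecomposable form has, up to sign, selfadjoint `m`-th roots. -/
theorem FormIndecomposable.exists_pow_eq_smul {n : ℕ} {V : Type*} [AddCommGroup V] [Module ℝ V]
    [FiniteDimensional ℝ V] [Nontrivial V] {G : MultilinearMap ℝ (fun _ : Fin n => V) ℝ}
    (hG : FormIndecomposable G) {τ : V →ₗ[ℝ] V} (hτ : FormSelfAdjoint G τ) (hu : IsUnit τ)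
    {m : ℕ} (hm : m ≠ 0) :
    ∃ ρ : V →ₗ[ℝ] V, FormSelfAdjoint G ρ ∧ ∃ ε : ℝ, (ε = 1 ∨ ε = -1) ∧ ρ ^ m = ε • τ := by
  obtain ⟨p, hp, k, hk⟩ := hG.exists_irreducible_pow hτ
  have hX : IsCoprime p X := by
    rw [hp.coprime_iff_not_dvd]
    intro hX
    obtain ⟨q, hq⟩ := pow_dvd_pow_of_dvd hX k
    have := congrArg (Polynomial.aeval τ) hq
    rw [map_mul, hk, zero_mul, map_pow, aeval_X] at this
    exact not_isUnit_zero (this ▸ hu.pow k)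
  obtain ⟨q, ε, hε, r, hr⟩ := hp.exists_pow_dvd_pow_sub hX k hm
  refine ⟨Polynomial.aeval τ q, hτ.aeval q, ε, hε, ?_⟩
  have := congrArg (Polynomial.aeval τ) hr
  rw [map_mul, hk, zero_mul, map_sub, sub_eq_zero, map_mul, aeval_X, map_pow, aeval_C] at this
  rw [this, Algebra.algebraMap_eq_smul_one, smul_one_mul]

section SymmEquiv

theorem Equiv.Perm.exists_apply_eq_and_apply_eq {α : Type*} [DecidableEq α] {i j k l : α}
    (hij : i ≠ j) (hkl : k ≠ l) : ∃ σ : Equiv.Perm α, σ i = k ∧ σ j = l := by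
  refine ⟨Equiv.swap (Equiv.swap j l i) k * Equiv.swap j l, by simp, ?_⟩
  have h1 : Equiv.swap j l i ≠ l := by
    rw [Ne, Equiv.swap_apply_eq_iff, Equiv.swap_apply_right]
    exact hij
  simp [Equiv.swap_apply_of_ne_of_ne h1.symm hkl.symm]

variable {K : Type*} [Field K] {n : ℕ} {U V W : Type*} [AddCommGroup U] [Module K U]
  [AddCommGroup V] [Module K V] [AddCommGroup W] [Module K W]
  {F : MultilinearMap K (fun _ : Fin n => U) K} {G : MultilinearMap K (fun _ : Fin n => V) K}
  {H : MultilinearMap K (fun _ : Fin n => W) K}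

theorem FormSymmEquiv.refl (F : MultilinearMap K (fun _ : Fin n => U) K) : FormSymmEquiv F F :=
  ⟨fun _ => LinearEquiv.refl K U, fun _ _ => rfl⟩

theorem FormSymmEquiv.symm (h : FormSymmEquiv F G) : FormSymmEquiv G F := by
  obtain ⟨φ, hφ⟩ := h
  refine ⟨fun k => (φ k).symm, fun σ v => ?_⟩
  rw [hφ σ]
  simp

theorem FormSymmEquiv.trans (h : FormSymmEquiv F G) (h' : FormSymmEquiv G H) :
    FormSymmEquiv F H := by
  obtain ⟨φ, hφ⟩ := h
  obtain ⟨ψ, hψ⟩ := h'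
  refine ⟨fun k => (φ k).trans (ψ k), fun σ v => ?_⟩
  rw [hφ σ, hψ σ]
  simp

theorem apply_update_of_symmEquiv {φ : Fin n → U ≃ₗ[K] V}
    (hφ : ∀ (σ : Equiv.Perm (Fin n)) (u : Fin n → U), F u = G fun i => φ (σ i) (u i))
    (σ : Equiv.Perm (Fin n)) (u : Fin n → U) (a : Fin n) (w : U) :
    F (update u a w) = G (update (fun i => φ (σ i) (u i)) a (φ (σ a) w)) := by
  rw [hφ σ]
  congr 1
  funext i
  rcases eq_or_ne i a with rfl | hi
  · simp
  · simp [hi]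

theorem FormSelfAdjoint.conj_update {φ : Fin n → U ≃ₗ[K] V}
    (hφ : ∀ (σ : Equiv.Perm (Fin n)) (u : Fin n → U), F u = G fun i => φ (σ i) (u i))
    {τ : V →ₗ[K] V} (hτ : FormSelfAdjoint G τ) (u : Fin n → U) {a b k l : Fin n} (hab : a ≠ b)
    (hkl : k ≠ l) :
    F (update u a ((φ k).symm (τ (φ k (u a))))) = F (update u b ((φ l).symm (τ (φ l (u b))))) := by
  obtain ⟨σ, rfl, rfl⟩ := Equiv.Perm.exists_apply_eq_and_apply_eq hab hkl
  rw [apply_update_of_symmEquiv hφ σ, apply_update_of_symmEquiv hφ σ, LinearEquiv.apply_symm_apply,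
    LinearEquiv.apply_symm_apply]
  exact hτ _ a b

theorem formSelfAdjoint_comp_symm {φ : Fin n → U ≃ₗ[K] V}
    (hφ : ∀ (σ : Equiv.Perm (Fin n)) (u : Fin n → U), F u = G fun i => φ (σ i) (u i))
    (k l : Fin n) : FormSelfAdjoint G ((φ k).toLinearMap ∘ₗ (φ l).symm.toLinearMap) := by
  rcases eq_or_ne k l with rfl | hkl
  · convert formSelfAdjoint_one
    ext; simp
  refine .of_ne fun v i j hij => ?_
  obtain ⟨σ, hi, hj⟩ := Equiv.Perm.exists_apply_eq_and_apply_eq hij hkl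
  set u : Fin n → U := fun m => (φ (σ m)).symm (update v i (φ k ((φ l).symm (v i))) m) with hu
  have h1 : G (update v i (φ k ((φ l).symm (v i)))) = F u := by
    rw [hφ σ]; simp [hu]
  simp only [LinearMap.comp_apply, LinearEquiv.coe_coe]
  rw [h1, hφ (σ * Equiv.swap i j)]
  congr 1
  funext m
  rcases eq_or_ne m i with rfl | hmi
  · simp [hu, hj, hi, hij]
  rcases eq_or_ne m j with rfl | hmj
  · simp [hu, hj, hi, hij.symm]
  · simp [hu, hmi, hmj, Equiv.swap_apply_of_ne_of_ne hmi hmj]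

/-- Symmetrically equivalent forms differ, up to congruence, by a selfadjoint operator in one
slot. -/
theorem exists_selfAdjoint_of_symmEquiv {φ : Fin n → U ≃ₗ[K] V}
    (hφ : ∀ (σ : Equiv.Perm (Fin n)) (u : Fin n → U), F u = G fun i => φ (σ i) (u i))
    (o : Fin n) : ∃ T : V →ₗ[K] V, FormSelfAdjoint G T ∧ IsUnit T ∧ ∀ (u : Fin n → U) (j : Fin n),
      F u = G (update (fun i => φ o (u i)) j (T (φ o (u j)))) := by
  set τ : Fin n → V →ₗ[K] V := fun k => (φ k).toLinearMap ∘ₗ (φ o).symm.toLinearMap with hτ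
  have hSA : ∀ k, FormSelfAdjoint G (τ k) := fun k => formSelfAdjoint_comp_symm hφ k o
  have ho : τ o = 1 := by ext; simp [hτ]
  have key : ∀ (u : Fin n → U) (j : Fin n),
      F u = G (update (fun i => φ o (u i)) j (((List.finRange n).map τ).prod (φ o (u j)))) := by
    intro u j
    have := FormSelfAdjoint.apply_collect hSA (Equiv.swap o j) j
      (fun l => by simp [ho]) (List.finRange n) (List.nodup_finRange n) (fun i => φ o (u i))
    rw [← this, hφ (Equiv.swap o j)]
    simp [hτ]
  refine ⟨_, ?_, ?_, key⟩
  · intro v i j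
    have hi := key (fun m => (φ o).symm (v m)) i
    have hj := key (fun m => (φ o).symm (v m)) j
    simp only [LinearEquiv.apply_symm_apply] at hi hj
    rw [← hi, ← hj]
  · refine Submonoid.list_prod_mem (IsUnit.submonoid (Module.End K V)) fun x hx => ?_
    obtain ⟨k, -, rfl⟩ := List.mem_map.1 hx
    exact (Module.End.isUnit_iff _).2 (((φ o).symm.trans (φ k)).bijective)

end SymmEquiv

theorem FormSymmEquiv.congruent_or_neg {n : ℕ} (hn : n ≠ 0) {U V : Type*}
    [AddCommGroup U] [Module ℝ U] [AddCommGroup V] [Module ℝ V] [FiniteDimensional ℝ V]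
    [Nontrivial V] {F : MultilinearMap ℝ (fun _ : Fin n => U) ℝ}
    {G : MultilinearMap ℝ (fun _ : Fin n => V) ℝ} (h : FormSymmEquiv F G)
    (hG : FormIndecomposable G) : FormCongruent F G ∨ FormCongruent F (-G) := by
  obtain ⟨φ, hφ⟩ := h
  let o : Fin n := ⟨0, Nat.pos_of_ne_zero hn⟩
  obtain ⟨T, hT, hTu, hFT⟩ := exists_selfAdjoint_of_symmEquiv hφ o
  obtain ⟨ρ, hρ, ε, hε, hpow⟩ := hG.exists_pow_eq_smul hT hTu hn
  have hρu : IsUnit ρ := by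
    rw [← isUnit_pow_iff hn, hpow]
    rcases hε with rfl | rfl
    · simpa using hTu
    · simpa using hTu.neg
  let ψ : U ≃ₗ[ℝ] V := (φ o).trans (LinearEquiv.ofBijective ρ ((Module.End.isUnit_iff _).1 hρu))
  have key : ∀ u : Fin n → U, G (fun i => ψ (u i)) = ε * F u := by
    intro u
    have := hρ.apply_comp_eq_pow (fun i => φ o (u i)) o
    rw [hFT u o, ← smul_eq_mul, ← MultilinearMap.map_update_smul, ← LinearMap.smul_apply, ← hpow,
      ← this]
    rfl
  rcases hε with rfl | rfl
  · exact Or.inl ⟨ψ, fun u => by simp [key]⟩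
  · exact Or.inr ⟨ψ, fun u => by simp [key]⟩

section Nondegenerate

variable {K : Type*} [Field K] {n : ℕ} {U V : Type*} [AddCommGroup U] [Module K U]
  [AddCommGroup V] [Module K V]
  {F : MultilinearMap K (fun _ : Fin n => U) K} {G : MultilinearMap K (fun _ : Fin n => V) K}

/-- A form is nondegenerate if only the zero vector makes it vanish from every slot. -/
def FormNondegenerate (G : MultilinearMap K (fun _ : Fin n => V) K) : Prop :=
  ∀ w : V, (∀ (v : Fin n → V) (k : Fin n), G (update v k w) = 0) → w = 0

theorem FormIndecomposable.nondegenerate (hn : n ≠ 0) (hG : FormIndecomposable G) (h0 : G ≠ 0) :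
    FormNondegenerate G := by
  let R : Submodule K V :=
    { carrier := {w | ∀ (v : Fin n → V) (k : Fin n), G (update v k w) = 0}
      add_mem' := fun {a b} ha hb v k => by rw [G.map_update_add, ha, hb, add_zero]
      zero_mem' := fun v k => G.map_update_zero v k
      smul_mem' := fun c a ha v k => by rw [G.map_update_smul, ha, smul_zero] }
  have hR : ∀ (v : Fin n → V) (k : Fin n), v k ∈ R → G v = 0 := fun v k hv => by
    simpa using hv v k
  obtain ⟨C, hC⟩ := R.exists_isCompl
  rcases hG R C hC (fun x k _ hk _ => hR x k hk) with h | h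
  · intro w hw
    have : w ∈ R := hw
    rwa [h, Submodule.mem_bot] at this
  · refine absurd (MultilinearMap.ext fun v => hR v ⟨0, Nat.pos_of_ne_zero hn⟩ ?_) h0
    have := hC.sup_eq_top
    rw [h, sup_bot_eq] at this
    rw [this]
    trivial

theorem FormNondegenerate.end_ext (hG : FormNondegenerate G) {α β : V →ₗ[K] V}
    (h : ∀ (v : Fin n → V) (k : Fin n), G (update v k (α (v k))) = G (update v k (β (v k)))) :
    α = β := by
  ext w
  rw [← sub_eq_zero]
  refine hG _ fun v k => ?_
  have := h (update v k w) k
  simp only [update_self, update_idem] at this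
  rw [G.map_update_sub, this, sub_self]

theorem FormNondegenerate.commute (hn : 3 ≤ n) (hG : FormNondegenerate G) {τ σ : V →ₗ[K] V}
    (hτ : FormSelfAdjoint G τ) (hσ : FormSelfAdjoint G σ) : Commute τ σ :=
  hG.end_ext fun v k => hτ.update_mul_comm_apply hn hσ v k

theorem nontrivial_of_form_ne_zero (hn : n ≠ 0) (h0 : G ≠ 0) : Nontrivial V := by
  by_contra h
  rw [not_nontrivial_iff_subsingleton] at h
  exact h0 (MultilinearMap.ext fun v =>
    G.map_coord_zero ⟨0, Nat.pos_of_ne_zero hn⟩ (Subsingleton.elim _ _))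

theorem FormNondegenerate.injective_of_apply_eq (hF : FormNondegenerate F)
    {θ : Fin n → U →ₗ[K] V}
    (h : ∀ (σ : Equiv.Perm (Fin n)) (u : Fin n → U), F u = G fun i => θ (σ i) (u i))
    (k : Fin n) : Injective (θ k) := by
  rw [← LinearMap.ker_eq_bot, LinearMap.ker_eq_bot']
  intro w hw
  refine hF w fun v i => ?_
  rw [h (Equiv.swap i k)]
  exact G.map_coord_zero i (by simpa using hw)

/-- Symmetric equivalence descends to nondegenerate quotients. -/
theorem FormSymmEquiv.of_retract {X Y : Type*} [AddCommGroup X] [Module K X]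
    [FiniteDimensional K X] [AddCommGroup Y] [Module K Y] [FiniteDimensional K Y]
    {P : MultilinearMap K (fun _ : Fin n => X) K} {Q : MultilinearMap K (fun _ : Fin n => Y) K}
    (hP : FormNondegenerate P) (hQ : FormNondegenerate Q) (h : FormSymmEquiv F G)
    (p : U →ₗ[K] X) (i : X →ₗ[K] U) (hpi : ∀ x, p (i x) = x)
    (hFP : ∀ u : Fin n → U, F u = P fun k => p (u k))
    (q : V →ₗ[K] Y) (j : Y →ₗ[K] V) (hqj : ∀ y, q (j y) = y)
    (hGQ : ∀ v : Fin n → V, G v = Q fun k => q (v k)) : FormSymmEquiv P Q := by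
  obtain ⟨φ, hφ⟩ := h
  have h1 : ∀ (σ : Equiv.Perm (Fin n)) (x : Fin n → X),
      P x = Q fun l => (q ∘ₗ (φ (σ l)).toLinearMap ∘ₗ i) (x l) := by
    intro σ x
    have : P x = F fun l => i (x l) := by simp [hFP, hpi]
    rw [this, hφ σ, hGQ]
    rfl
  have h2 : ∀ (σ : Equiv.Perm (Fin n)) (y : Fin n → Y),
      Q y = P fun l => (p ∘ₗ (φ (σ l)).symm.toLinearMap ∘ₗ j) (y l) := by
    intro σ y
    have : Q y = G fun l => j (y l) := by simp [hGQ, hqj]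
    rw [this]
    have h3 := hφ σ fun l => (φ (σ l)).symm (j (y l))
    simp only [LinearEquiv.apply_symm_apply] at h3
    rw [← h3, hFP]
    rfl
  have i1 := hP.injective_of_apply_eq (θ := fun k => q ∘ₗ (φ k).toLinearMap ∘ₗ i) h1
  have i2 := hQ.injective_of_apply_eq (θ := fun k => p ∘ₗ (φ k).symm.toLinearMap ∘ₗ j) h2
  have hdim : Fin n → Module.finrank K X = Module.finrank K Y := fun k =>
    le_antisymm (LinearMap.finrank_le_finrank_of_injective (i1 k))
      (LinearMap.finrank_le_finrank_of_injective (i2 k))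
  exact ⟨fun k => LinearMap.linearEquivOfInjective _ (i1 k) (hdim k), fun σ x => h1 σ x⟩

end Nondegenerate

section PiForm

variable {K : Type*} [Field K] {n : ℕ} {ι : Type*} [Fintype ι] [DecidableEq ι] {E : ι → Type*}
  [∀ i, AddCommGroup (E i)] [∀ i, Module K (E i)]

/-- The orthogonal direct sum of a finite family of forms. -/
def piForm (H : ∀ i, MultilinearMap K (fun _ : Fin n => E i) K) :
    MultilinearMap K (fun _ : Fin n => ∀ i, E i) K :=
  ∑ i, (H i).compLinearMap fun _ => LinearMap.proj i

variable {H : ∀ i, MultilinearMap K (fun _ : Fin n => E i) K}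

omit [DecidableEq ι] in
theorem piForm_apply (x : Fin n → ∀ i, E i) : piForm H x = ∑ i, H i fun k => x k i := by
  simp [piForm]

variable (K E) in
/-- The projection of a product onto one of its factors, as an endomorphism. -/
def blockProj (i : ι) : (∀ i, E i) →ₗ[K] ∀ i, E i := LinearMap.single K E i ∘ₗ LinearMap.proj i

omit [Fintype ι] in
theorem blockProj_apply (i : ι) (x : ∀ i, E i) : blockProj K E i x = Pi.single i (x i) := rfl

omit [Fintype ι] in
theorem blockProj_mul_self (i : ι) : blockProj K E i * blockProj K E i = blockProj K E i := by
  refine LinearMap.ext fun x => ?_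
  simp [blockProj_apply]

theorem sum_blockProj : ∑ i, blockProj K E i = 1 := by
  refine LinearMap.ext fun x => ?_
  simp [blockProj_apply, LinearMap.sum_apply, Finset.univ_sum_single]

omit [Fintype ι] in
theorem blockProj_ne_zero (i : ι) [Nontrivial (E i)] : blockProj K E i ≠ 0 := by
  obtain ⟨x, hx⟩ := exists_ne (0 : E i)
  intro h
  have := congrFun (LinearMap.congr_fun h (Pi.single i x)) i
  exact hx (by simpa [blockProj_apply] using this)

theorem piForm_update_single (x : Fin n → ∀ i, E i) (k : Fin n) (i : ι) (w : E i) :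
    piForm H (update x k (Pi.single i w)) = H i (update (fun l => x l i) k w) := by
  rw [piForm_apply, Finset.sum_eq_single i]
  · congr 1
    funext l
    rcases eq_or_ne l k with rfl | hl
    · simp
    · simp [hl]
  · intro j _ hj
    exact (H j).map_coord_zero k (by simp [hj])
  · simp

theorem piForm_single (hn : n ≠ 0) (i : ι) (x : Fin n → E i) :
    piForm H (fun k => Pi.single i (x k)) = H i x := by
  have := piForm_update_single (H := H) (fun k => Pi.single i (x k)) ⟨0, Nat.pos_of_ne_zero hn⟩ i
    (x ⟨0, Nat.pos_of_ne_zero hn⟩)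
  rw [update_eq_self] at this
  rw [this]
  simp

theorem formSelfAdjoint_blockProj (i : ι) : FormSelfAdjoint (piForm H) (blockProj K E i) := by
  intro v a b
  rw [blockProj_apply, blockProj_apply, piForm_update_single, piForm_update_single]
  simp

theorem piForm_nondegenerate (hn : 2 ≤ n) (hH : ∀ i, FormNondegenerate (H i)) :
    FormNondegenerate (piForm H) := by
  intro w hw
  funext i
  refine hH i _ fun x k => ?_
  obtain ⟨l, hl⟩ : ∃ l : Fin n, l ≠ k := by
    have : Nontrivial (Fin n) := Fin.nontrivial_iff_two_le.2 hn
    exact exists_ne k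
  have h1 := piForm_update_single (H := H) (update (fun l => Pi.single i (x l)) k w) l i (x l)
  rw [update_comm hl.symm, ← update_eq_self l (fun l => (Pi.single i (x l) : ∀ i, E i)),
    update_idem, update_eq_self, hw] at h1
  rw [h1]
  congr 1
  funext m
  rcases eq_or_ne m l with rfl | hml
  · simp [hl]
  rcases eq_or_ne m k with rfl | hmk
  · simp [hml]
  · simp [hml, hmk]

/-- For nondegenerate sums of indecomposables with at least three slots, selfadjoint idempotents
are block diagonal with blocks `0` and `1`. -/
theorem FormSelfAdjoint.mul_blockProj_eq (hn : 3 ≤ n) (hH : ∀ i, FormNondegenerate (H i))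
    (hind : ∀ i, FormIndecomposable (H i)) {A : (∀ i, E i) →ₗ[K] ∀ i, E i}
    (hA : FormSelfAdjoint (piForm H) A) (hidem : A * A = A) (i : ι) :
    Commute A (blockProj K E i) ∧ (A * blockProj K E i = 0 ∨
      A * blockProj K E i = blockProj K E i) := by
  have hcomm : Commute A (blockProj K E i) :=
    (piForm_nondegenerate (by omega) hH).commute hn hA (formSelfAdjoint_blockProj i)
  refine ⟨hcomm, ?_⟩
  let e : E i →ₗ[K] E i := LinearMap.proj i ∘ₗ A ∘ₗ LinearMap.single K E i
  have hAe : ∀ x, A (Pi.single i x) = Pi.single i (e x) := by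
    intro x
    have := LinearMap.congr_fun hcomm.eq (Pi.single i x)
    simpa [blockProj_apply, e] using this
  have he : e * e = e := by
    refine LinearMap.ext fun x => Pi.single_injective (M := E) i ?_
    change Pi.single i (e (e x)) = Pi.single i (e x)
    rw [← hAe (e x), ← hAe x, ← Module.End.mul_apply, hidem]
  have heSA : FormSelfAdjoint (H i) e := by
    intro x a b
    have := hA (fun k => Pi.single i (x k)) a b
    rw [hAe, hAe, piForm_update_single, piForm_update_single] at this
    simpa using this
  have hcop : IsCoprime (X : K[X]) (X - 1) := ⟨1, -1, by ring⟩
  rcases (hind i).ker_eq_bot_or_of_isCoprime heSA hcop (by simp [mul_sub, he]) with h | h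
  · left
    refine LinearMap.ext fun x => ?_
    rw [Module.End.mul_apply, blockProj_apply, hAe]
    rw [aeval_X] at h
    simp [h]
  · right
    refine LinearMap.ext fun x => ?_
    rw [Module.End.mul_apply, blockProj_apply, hAe]
    rw [map_sub, aeval_X, map_one, sub_eq_zero] at h
    simp [h]

variable {κ : Type*} [Fintype κ] [DecidableEq κ] {E' : κ → Type*}
  [∀ i, AddCommGroup (E' i)] [∀ i, Module K (E' i)]
  {H' : ∀ i, MultilinearMap K (fun _ : Fin n => E' i) K}

theorem conj_blockProj (hn : 3 ≤ n) (hH : ∀ i, FormNondegenerate (H i))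
    {φ : Fin n → (∀ i, E i) ≃ₗ[K] (∀ i, E' i)}
    (hφ : ∀ (σ : Equiv.Perm (Fin n)) (u : Fin n → ∀ i, E i),
      piForm H u = piForm H' fun i => φ (σ i) (u i)) (j : κ) (k l : Fin n) :
    (φ k).symm.conj (blockProj K E' j) = (φ l).symm.conj (blockProj K E' j) := by
  refine (piForm_nondegenerate (by omega) hH).end_ext fun v a => ?_
  obtain ⟨m, hmk, hml⟩ := Fin.exists_ne_and_ne_of_two_lt k l hn
  obtain ⟨b, hb, -⟩ := Fin.exists_ne_and_ne_of_two_lt a a hn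
  simp only [LinearEquiv.conj_apply_apply, LinearEquiv.symm_symm]
  rw [(formSelfAdjoint_blockProj j).conj_update hφ v hb.symm hmk.symm,
    (formSelfAdjoint_blockProj j).conj_update hφ v hb.symm hml.symm]

theorem formSelfAdjoint_conj_blockProj (hn : 3 ≤ n) (hH : ∀ i, FormNondegenerate (H i))
    {φ : Fin n → (∀ i, E i) ≃ₗ[K] (∀ i, E' i)}
    (hφ : ∀ (σ : Equiv.Perm (Fin n)) (u : Fin n → ∀ i, E i),
      piForm H u = piForm H' fun i => φ (σ i) (u i)) (j : κ) (k : Fin n) :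
    FormSelfAdjoint (piForm H) ((φ k).symm.conj (blockProj K E' j)) := by
  refine .of_ne fun v a b hab => ?_
  obtain ⟨l, hl, -⟩ := Fin.exists_ne_and_ne_of_two_lt k k hn
  have h1 := (formSelfAdjoint_blockProj (H := H') j).conj_update hφ v hab hl.symm
  have h2 := conj_blockProj hn hH hφ j k l
  have h3 : (φ k).symm (blockProj K E' j (φ k (v a))) =
      (φ l).symm (blockProj K E' j (φ l (v a))) := LinearMap.congr_fun h2 (v a)
  rw [h3] at h1
  rw [h2]
  exact h1

theorem exists_conj_blockProj_eq (hn : 3 ≤ n) (hH : ∀ i, FormNondegenerate (H i))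
    (hind : ∀ i, FormIndecomposable (H i)) [∀ i, Nontrivial (E i)]
    (hH' : ∀ i, FormNondegenerate (H' i)) (hind' : ∀ i, FormIndecomposable (H' i))
    {φ : Fin n → (∀ i, E i) ≃ₗ[K] (∀ i, E' i)}
    (hφ : ∀ (σ : Equiv.Perm (Fin n)) (u : Fin n → ∀ i, E i),
      piForm H u = piForm H' fun i => φ (σ i) (u i)) (i : ι) :
    ∃ j, ∀ k x, φ k (blockProj K E i x) = blockProj K E' j (φ k x) := by
  let o : Fin n := ⟨0, by omega⟩
  let A : κ → Module.End K (∀ i, E i) := fun j => (φ o).symm.conj (blockProj K E' j)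
  have hφ' : ∀ (σ : Equiv.Perm (Fin n)) (v : Fin n → ∀ i, E' i),
      piForm H' v = piForm H fun i => (φ (σ i)).symm (v i) := by
    intro σ v
    rw [hφ σ]
    simp
  have hsum : ∑ j, A j = 1 := by
    rw [← map_sum, sum_blockProj]
    exact LinearEquiv.conj_id _
  have hmul : ∀ f g : Module.End K (∀ i, E' i),
      (φ o).symm.conj f * (φ o).symm.conj g = (φ o).symm.conj (f * g) := fun f g =>
    ((φ o).symm.conj_comp g f).symm
  have hAA : ∀ j, A j * A j = A j := fun j => by
    simp only [A, hmul, blockProj_mul_self]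
  obtain ⟨j, hj⟩ : ∃ j, A j * blockProj K E i = blockProj K E i := by
    by_contra! hne
    have h0 : ∀ j, A j * blockProj K E i = 0 := fun j =>
      ((formSelfAdjoint_conj_blockProj hn hH hφ j o).mul_blockProj_eq hn hH hind (hAA j)
        i).2.resolve_right (hne j)
    refine blockProj_ne_zero (K := K) (E := E) i ?_
    rw [← one_mul (blockProj K E i), ← hsum, Finset.sum_mul, Finset.sum_eq_zero fun j _ => h0 j]
  have hcomm := ((formSelfAdjoint_conj_blockProj hn hH hφ j o).mul_blockProj_eq hn hH hind
    (hAA j) i).1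
  have hB := ((formSelfAdjoint_conj_blockProj hn hH' (φ := fun k => (φ k).symm) hφ' i
    o).mul_blockProj_eq hn hH' hind' (by
      rw [Module.End.mul_eq_comp, ← LinearEquiv.conj_comp, ← Module.End.mul_eq_comp,
        blockProj_mul_self]) j).2
  have hconj : (φ o).symm.conj ((φ o).symm.symm.conj (blockProj K E i) * blockProj K E' j) =
      blockProj K E i * A j := by
    rw [← hmul, LinearEquiv.conj_conj_symm]
  have hij : A j = blockProj K E i := by
    rcases hB with h | h
    · rw [h, map_zero, ← hcomm.eq, hj] at hconj
      exact absurd hconj.symm (blockProj_ne_zero i)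
    · rw [h, ← hcomm.eq, hj] at hconj
      exact hconj
  refine ⟨j, fun k x => ?_⟩
  have := LinearMap.congr_fun ((conj_blockProj hn hH hφ j k o).trans hij) x
  rw [LinearEquiv.conj_apply_apply, LinearEquiv.symm_apply_eq] at this
  exact this.symm

theorem exists_equiv_formSymmEquiv_of_three_le (hn : 3 ≤ n) (hH : ∀ i, FormNondegenerate (H i))
    (hind : ∀ i, FormIndecomposable (H i)) [∀ i, Nontrivial (E i)]
    (hH' : ∀ i, FormNondegenerate (H' i)) (hind' : ∀ i, FormIndecomposable (H' i))
    [∀ i, Nontrivial (E' i)] (h : FormSymmEquiv (piForm H) (piForm H')) :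
    ∃ e : ι ≃ κ, ∀ i, FormSymmEquiv (H i) (H' (e i)) := by
  obtain ⟨φ, hφ⟩ := h
  have hφ' : ∀ (σ : Equiv.Perm (Fin n)) (v : Fin n → ∀ i, E' i),
      piForm H' v = piForm H fun i => (φ (σ i)).symm (v i) := by
    intro σ v
    rw [hφ σ]
    simp
  choose f hf using exists_conj_blockProj_eq hn hH hind hH' hind' hφ
  choose g hg using exists_conj_blockProj_eq hn hH' hind' hH hind
    (φ := fun k => (φ k).symm) hφ'
  have inj : ∀ i i' : ι, blockProj K E i = blockProj K E i' → i = i' := by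
    intro i i' h
    obtain ⟨x, hx⟩ := exists_ne (0 : E i)
    by_contra hne
    have := congrFun (LinearMap.congr_fun h (Pi.single i x)) i
    simp [blockProj_apply, hne] at this
    exact hx this
  have inj' : ∀ i i' : κ, blockProj K E' i = blockProj K E' i' → i = i' := by
    intro i i' h
    obtain ⟨x, hx⟩ := exists_ne (0 : E' i)
    by_contra hne
    have := congrFun (LinearMap.congr_fun h (Pi.single i x)) i
    simp [blockProj_apply, hne] at this
    exact hx this
  let o : Fin n := ⟨0, by omega⟩
  have hgf : ∀ i, g (f i) = i := by
    intro i
    refine inj _ _ (LinearMap.ext fun x => ?_)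
    have := hg (f i) o (φ o x)
    rw [← hf, LinearEquiv.symm_apply_apply, LinearEquiv.symm_apply_apply] at this
    exact this.symm
  have hfg : ∀ j, f (g j) = j := by
    intro j
    refine inj' _ _ (LinearMap.ext fun x => ?_)
    have := hf (g j) o ((φ o).symm x)
    rw [← hg, LinearEquiv.apply_symm_apply, LinearEquiv.apply_symm_apply] at this
    exact this.symm
  refine ⟨⟨f, g, hgf, hfg⟩, fun i => ?_⟩
  change FormSymmEquiv (H i) (H' (f i))
  have h1 : ∀ k (x : E i), φ k (Pi.single i x) = Pi.single (f i) (φ k (Pi.single i x) (f i)) := by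
    intro k x
    have := hf i k (Pi.single i x)
    simpa [blockProj_apply] using this
  have h2 : ∀ k (y : E' (f i)),
      (φ k).symm (Pi.single (f i) y) = Pi.single i ((φ k).symm (Pi.single (f i) y) i) := by
    intro k y
    have := hg (f i) k (Pi.single (f i) y)
    rw [hgf] at this
    simpa [blockProj_apply] using this
  refine ⟨fun k => LinearEquiv.ofLinearMap
    (LinearMap.proj (f i) ∘ₗ (φ k).toLinearMap ∘ₗ LinearMap.single K E i)
    (LinearMap.proj i ∘ₗ (φ k).symm.toLinearMap ∘ₗ LinearMap.single K E' (f i)) ?_ ?_,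
    fun σ x => ?_⟩
  · refine LinearMap.ext fun y => ?_
    simp [← h2]
  · refine LinearMap.ext fun x => ?_
    simp [← h1]
  · rw [← piForm_single (H := H) (by omega) i x, hφ σ]
    change _ = H' (f i) fun k => φ (σ k) (Pi.single i (x k)) (f i)
    rw [← piForm_single (H := H') (by omega) (f i)]
    congr 1
    funext k
    exact h1 _ _

end PiForm

section Bilinear

variable {W U V : Type*} [AddCommGroup W] [Module ℝ W] [AddCommGroup U] [Module ℝ U]
  [AddCommGroup V] [Module ℝ V]
  {H : MultilinearMap ℝ (fun _ : Fin 2 => W) ℝ} {F : MultilinearMap ℝ (fun _ : Fin 2 => U) ℝ}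
  {G : MultilinearMap ℝ (fun _ : Fin 2 => V) ℝ}

omit [AddCommGroup U] [Module ℝ U] in
theorem update_vec_zero (x y z : U) : update ![x, y] 0 z = ![z, y] := by
  funext i
  fin_cases i <;> rfl

omit [AddCommGroup U] [Module ℝ U] in
theorem update_vec_one (x y z : U) : update ![x, y] 1 z = ![x, z] := by
  funext i
  fin_cases i <;> rfl

/-- The bilinear map underlying a multilinear form with two slots. -/
def formBilin (F : MultilinearMap ℝ (fun _ : Fin 2 => U) ℝ) : U →ₗ[ℝ] U →ₗ[ℝ] ℝ :=
  LinearMap.mk₂ ℝ (fun x y => F ![x, y])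
    (fun x x' y => by
      have := F.map_update_add ![x, y] 0 x x'
      rwa [update_vec_zero, update_vec_zero, update_vec_zero] at this)
    (fun c x y => by
      have := F.map_update_smul ![x, y] 0 c x
      rwa [update_vec_zero, update_vec_zero] at this)
    (fun x y y' => by
      have := F.map_update_add ![x, y] 1 y y'
      rwa [update_vec_one, update_vec_one, update_vec_one] at this)
    (fun c x y => by
      have := F.map_update_smul ![x, y] 1 c y
      rwa [update_vec_one, update_vec_one] at this)

theorem formBilin_apply (x y : U) : formBilin F x y = F ![x, y] := rfl

theorem form_eq_formBilin (u : Fin 2 → U) : F u = formBilin F (u 0) (u 1) := by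
  rw [formBilin_apply]
  congr 1
  funext i
  fin_cases i <;> rfl

theorem formSymmEquiv_iff_formBilin : FormSymmEquiv F G ↔ ∃ φ ψ : U ≃ₗ[ℝ] V,
    (∀ x y, formBilin F x y = formBilin G (φ x) (ψ y)) ∧
      ∀ x y, formBilin F x y = formBilin G (ψ x) (φ y) := by
  constructor
  · rintro ⟨φ, hφ⟩
    refine ⟨φ 0, φ 1, fun x y => ?_, fun x y => ?_⟩
    · rw [formBilin_apply, hφ 1, form_eq_formBilin]
      rfl
    · rw [formBilin_apply, hφ (Equiv.swap 0 1), form_eq_formBilin]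
      rfl
  · rintro ⟨φ, ψ, h1, h2⟩
    refine ⟨![φ, ψ], fun σ u => ?_⟩
    rw [form_eq_formBilin u, form_eq_formBilin]
    have h01 : σ 0 ≠ σ 1 := σ.injective.ne (by decide)
    obtain ⟨h, h'⟩ | ⟨h, h'⟩ : (σ 0 = 0 ∧ σ 1 = 1) ∨ (σ 0 = 1 ∧ σ 1 = 0) := by omega
    · rw [h, h']
      exact h1 _ _
    · rw [h, h']
      exact h2 _ _

theorem formSelfAdjoint_iff_formBilin {τ : W →ₗ[ℝ] W} :
    FormSelfAdjoint H τ ↔ ∀ x y, formBilin H (τ x) y = formBilin H x (τ y) := by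
  constructor
  · intro h x y
    have := h ![x, y] 0 1
    simpa [form_eq_formBilin] using this
  · intro h
    refine .of_ne fun v i j hij => ?_
    obtain ⟨rfl, rfl⟩ | ⟨rfl, rfl⟩ : (i = 0 ∧ j = 1) ∨ (i = 1 ∧ j = 0) := by omega
    · simp [form_eq_formBilin, h]
    · simp [form_eq_formBilin, h]

variable (H F) in
/-- Pairs of mutually adjoint linear maps between the spaces of two bilinear forms. -/
def adjointPairs : Submodule ℝ ((W →ₗ[ℝ] U) × (U →ₗ[ℝ] W)) where
  carrier := {p | ∀ x u, formBilin F (p.1 x) u = formBilin H x (p.2 u) ∧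
    formBilin F u (p.1 x) = formBilin H (p.2 u) x}
  add_mem' {p q} hp hq x u := by simp [(hp x u).1, (hp x u).2, (hq x u).1, (hq x u).2]
  zero_mem' x u := by simp
  smul_mem' c p hp x u := by simp [(hp x u).1, (hp x u).2]

theorem mem_adjointPairs {p : (W →ₗ[ℝ] U) × (U →ₗ[ℝ] W)} : p ∈ adjointPairs H F ↔
    ∀ x u, formBilin F (p.1 x) u = formBilin H x (p.2 u) ∧
      formBilin F u (p.1 x) = formBilin H (p.2 u) x := Iff.rfl

/-- The endomorphism attached to two pairs of maps going back and forth. -/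
def pairing (p q : (W →ₗ[ℝ] U) × (U →ₗ[ℝ] W)) : W →ₗ[ℝ] W := p.2 ∘ₗ q.1 + q.2 ∘ₗ p.1

theorem pairing_add_left (p p' q : (W →ₗ[ℝ] U) × (U →ₗ[ℝ] W)) :
    pairing (p + p') q = pairing p q + pairing p' q := by
  simp only [pairing, Prod.fst_add, Prod.snd_add, LinearMap.add_comp, LinearMap.comp_add]
  abel

theorem pairing_smul_left (c : ℝ) (p q : (W →ₗ[ℝ] U) × (U →ₗ[ℝ] W)) :
    pairing (c • p) q = c • pairing p q := by
  simp [pairing, LinearMap.smul_comp, LinearMap.comp_smul]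

theorem pairing_polarization (p q : (W →ₗ[ℝ] U) × (U →ₗ[ℝ] W)) :
    pairing p q = (p + q).2 ∘ₗ (p + q).1 - p.2 ∘ₗ p.1 - q.2 ∘ₗ q.1 := by
  simp only [pairing, Prod.fst_add, Prod.snd_add, LinearMap.add_comp, LinearMap.comp_add]
  abel

theorem formSelfAdjoint_comp_of_mem {p : (W →ₗ[ℝ] U) × (U →ₗ[ℝ] W)}
    (hp : p ∈ adjointPairs H F) : FormSelfAdjoint H (p.2 ∘ₗ p.1) := by
  rw [formSelfAdjoint_iff_formBilin]
  intro x y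
  rw [LinearMap.comp_apply, LinearMap.comp_apply, ← (hp _ _).1, ← (hp _ _).2]

variable (H) in
/-- The span of the nilpotent selfadjoint endomorphisms. -/
def nilSelfAdjoint : Submodule ℝ (W →ₗ[ℝ] W) :=
  Submodule.span ℝ {a | FormSelfAdjoint H a ∧ IsNilpotent a}

theorem FormSelfAdjoint.mul_mul {ρ a : W →ₗ[ℝ] W} (hρ : FormSelfAdjoint H ρ)
    (ha : FormSelfAdjoint H a) : FormSelfAdjoint H (ρ * a * ρ) := by
  rw [formSelfAdjoint_iff_formBilin] at *
  intro x y
  simp only [Module.End.mul_apply, hρ, ha]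

theorem FormSelfAdjoint.inv {u : (W →ₗ[ℝ] W)ˣ} (hu : FormSelfAdjoint H (u : W →ₗ[ℝ] W)) :
    FormSelfAdjoint H (↑u⁻¹ : W →ₗ[ℝ] W) := by
  rw [formSelfAdjoint_iff_formBilin] at *
  intro x y
  have h : ∀ z, (u : W →ₗ[ℝ] W) ((↑u⁻¹ : W →ₗ[ℝ] W) z) = z := fun z => by
    rw [← Module.End.mul_apply, Units.mul_inv, Module.End.one_apply]
  have := hu ((↑u⁻¹ : W →ₗ[ℝ] W) x) ((↑u⁻¹ : W →ₗ[ℝ] W) y)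
  rw [h, h] at this
  exact this.symm

variable [FiniteDimensional ℝ W] [Nontrivial W]

theorem FormIndecomposable.isNilpotent_add (hH : FormIndecomposable H) {a b : W →ₗ[ℝ] W}
    (ha : FormSelfAdjoint H a) (hb : FormSelfAdjoint H b) (na : IsNilpotent a)
    (nb : IsNilpotent b) : IsNilpotent (a + b) := by
  refine (hH.isNilpotent_or_isUnit (ha.add hb)).resolve_right fun hc => ?_
  obtain ⟨ρ, hρ, ε, hε, hsq⟩ := hH.exists_pow_eq_smul (ha.add hb) hc two_ne_zero
  have hε0 : ε ≠ 0 := by rcases hε with rfl | rfl <;> norm_num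
  have hρu : IsUnit ρ := by
    rw [← isUnit_pow_iff two_ne_zero, hsq]
    exact hc.smul (Units.mk0 ε hε0)
  obtain ⟨u, rfl⟩ := hρu
  have hui := hρ.inv
  have key : (↑u⁻¹ : W →ₗ[ℝ] W) * a * ↑u⁻¹ + ↑u⁻¹ * b * ↑u⁻¹ = algebraMap ℝ _ ε := by
    have h1 : a + b = ε • ((u : W →ₗ[ℝ] W) ^ 2) := by
      rw [hsq, smul_smul]
      rcases hε with rfl | rfl <;> norm_num
    rw [← add_mul, ← mul_add, h1, sq, mul_smul_comm, smul_mul_assoc, Units.inv_mul_cancel_left,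
      Units.mul_inv, Algebra.algebraMap_eq_smul_one]
  have hna : ¬ IsUnit a := fun h => not_isUnit_zero (by
    obtain ⟨k, hk⟩ := na
    exact hk ▸ h.pow k)
  have hnb : ¬ IsUnit b := fun h => not_isUnit_zero (by
    obtain ⟨k, hk⟩ := nb
    exact hk ▸ h.pow k)
  have hnil := (hH.isNilpotent_or_isUnit (hui.mul_mul ha)).resolve_right
    (by simpa using hna)
  refine hnb ?_
  have hu' : IsUnit ((↑u⁻¹ : W →ₗ[ℝ] W) * b * ↑u⁻¹) := by
    rw [← eq_sub_iff_add_eq'] at key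
    rw [key, sub_eq_add_neg]
    exact (IsNilpotent.neg hnil).isUnit_add_left_of_commute ((Units.mk0 ε hε0).isUnit.map _)
      (Algebra.commutes _ _).symm
  simpa using hu'

theorem FormIndecomposable.mem_nilSelfAdjoint (hH : FormIndecomposable H) {a : W →ₗ[ℝ] W} :
    a ∈ nilSelfAdjoint H ↔ FormSelfAdjoint H a ∧ IsNilpotent a := by
  refine ⟨fun h => ?_, fun h => Submodule.subset_span h⟩
  induction h using Submodule.span_induction with
  | mem x hx => exact hx
  | zero => exact ⟨by simpa using (formSelfAdjoint_one (G := H)).smul 0, .zero⟩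
  | add x y _ _ hx hy => exact ⟨hx.1.add hy.1, hH.isNilpotent_add hx.1 hy.1 hx.2 hy.2⟩
  | smul c x _ hx => exact ⟨hx.1.smul c, hx.2.smul c⟩

end Bilinear

section Multiplicity

variable {W U V : Type*} [AddCommGroup W] [Module ℝ W] [AddCommGroup U] [Module ℝ U]
  [AddCommGroup V] [Module ℝ V]
  {H : MultilinearMap ℝ (fun _ : Fin 2 => W) ℝ} {F : MultilinearMap ℝ (fun _ : Fin 2 => U) ℝ}
  {G : MultilinearMap ℝ (fun _ : Fin 2 => V) ℝ}

variable (H F) in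
/-- The radical of the pairing on adjoint pairs modulo nilpotent selfadjoint endomorphisms. -/
def pairingRadical : Submodule ℝ ((W →ₗ[ℝ] U) × (U →ₗ[ℝ] W)) where
  carrier := {p | p ∈ adjointPairs H F ∧ ∀ q ∈ adjointPairs H F, pairing p q ∈ nilSelfAdjoint H}
  add_mem' {p p'} hp hp' := ⟨add_mem hp.1 hp'.1, fun q hq => by
    rw [pairing_add_left]
    exact add_mem (hp.2 q hq) (hp'.2 q hq)⟩
  zero_mem' := ⟨zero_mem _, fun q _ => by simp [pairing]⟩
  smul_mem' c p hp := ⟨Submodule.smul_mem _ c hp.1, fun q hq => by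
    rw [pairing_smul_left]
    exact Submodule.smul_mem _ c (hp.2 q hq)⟩

theorem mem_pairingRadical {p : (W →ₗ[ℝ] U) × (U →ₗ[ℝ] W)} : p ∈ pairingRadical H F ↔
    p ∈ adjointPairs H F ∧ ∀ q ∈ adjointPairs H F, pairing p q ∈ nilSelfAdjoint H := Iff.rfl

variable (H F) in
/-- The rank of the pairing on adjoint pairs modulo nilpotent selfadjoint endomorphisms. For
indecomposable `H` it is proportional to the number of summands of `F` equivalent to `H`. -/
noncomputable def pairingRank : ℤ :=
  Module.finrank ℝ (adjointPairs H F) - Module.finrank ℝ (pairingRadical H F)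

theorem LinearEquiv.finrank_eq_of_mem_iff {M N : Type*} [AddCommGroup M] [Module ℝ M]
    [AddCommGroup N] [Module ℝ N] (e : M ≃ₗ[ℝ] N) {p : Submodule ℝ M} {q : Submodule ℝ N}
    (h : ∀ x, e x ∈ q ↔ x ∈ p) : Module.finrank ℝ p = Module.finrank ℝ q := by
  have : p = q.comap (e : M →ₗ[ℝ] N) := Submodule.ext fun x => (h x).symm
  subst this
  exact (e.ofSubmodule' q).finrank_eq

theorem mem_adjointPairs_congr_iff {φ ψ : U ≃ₗ[ℝ] V}
    (h1 : ∀ x y, formBilin F x y = formBilin G (φ x) (ψ y))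
    (h2 : ∀ x y, formBilin F x y = formBilin G (ψ x) (φ y))
    (p : (W →ₗ[ℝ] U) × (U →ₗ[ℝ] W)) :
    ((φ.toLinearMap ∘ₗ p.1, p.2 ∘ₗ ψ.symm.toLinearMap) : (W →ₗ[ℝ] V) × (V →ₗ[ℝ] W)) ∈
      adjointPairs H G ↔ p ∈ adjointPairs H F := by
  rw [mem_adjointPairs, mem_adjointPairs]
  refine forall_congr' fun x => ?_
  rw [← ψ.toEquiv.forall_congr_right]
  simp [h1 (p.1 x), h2 _ (p.1 x)]

theorem FormSymmEquiv.pairingRank_eq (h : FormSymmEquiv F G) :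
    pairingRank H F = pairingRank H G := by
  obtain ⟨φ, ψ, h1, h2⟩ := formSymmEquiv_iff_formBilin.1 h
  let T : ((W →ₗ[ℝ] U) × (U →ₗ[ℝ] W)) ≃ₗ[ℝ] (W →ₗ[ℝ] V) × (V →ₗ[ℝ] W) :=
    ((LinearEquiv.refl ℝ W).arrowCongr φ).prodCongr (ψ.arrowCongr (LinearEquiv.refl ℝ W))
  let T' : ((W →ₗ[ℝ] U) × (U →ₗ[ℝ] W)) ≃ₗ[ℝ] (W →ₗ[ℝ] V) × (V →ₗ[ℝ] W) :=
    ((LinearEquiv.refl ℝ W).arrowCongr ψ).prodCongr (φ.arrowCongr (LinearEquiv.refl ℝ W))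
  have hT : ∀ p, T p ∈ adjointPairs H G ↔ p ∈ adjointPairs H F :=
    mem_adjointPairs_congr_iff h1 h2
  have hT' : ∀ p, T' p ∈ adjointPairs H G ↔ p ∈ adjointPairs H F :=
    mem_adjointPairs_congr_iff h2 h1
  have hpair : ∀ p q, pairing (T p) (T' q) = pairing p q := fun p q => by
    refine LinearMap.ext fun x => ?_
    simp [pairing, T, T', LinearEquiv.arrowCongr_apply]
  unfold pairingRank
  rw [T.finrank_eq_of_mem_iff hT, T.finrank_eq_of_mem_iff (q := pairingRadical H G)]
  intro p
  rw [mem_pairingRadical, mem_pairingRadical, hT, ← T'.toEquiv.forall_congr_right]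
  simp only [LinearEquiv.coe_toEquiv, hT', hpair]

section Additivity

variable {ι : Type*} [Fintype ι] [DecidableEq ι] {E : ι → Type*}
  [∀ i, AddCommGroup (E i)] [∀ i, Module ℝ (E i)]
  {P : ∀ i, MultilinearMap ℝ (fun _ : Fin 2 => E i) ℝ}

omit [DecidableEq ι] in
theorem formBilin_piForm (x y : ∀ i, E i) :
    formBilin (piForm P) x y = ∑ i, formBilin (P i) (x i) (y i) := by
  rw [formBilin_apply, piForm_apply]
  refine Finset.sum_congr rfl fun i _ => ?_
  rw [form_eq_formBilin]
  rfl

variable (W E) in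
/-- A pair of maps to and from a finite product, split into its components. -/
def pairsPiEquiv : ((W →ₗ[ℝ] ∀ i, E i) × ((∀ i, E i) →ₗ[ℝ] W)) ≃ₗ[ℝ]
    ∀ i, (W →ₗ[ℝ] E i) × (E i →ₗ[ℝ] W) where
  toFun p i := (LinearMap.proj i ∘ₗ p.1, p.2 ∘ₗ LinearMap.single ℝ E i)
  map_add' p q := by
    funext i
    simp [LinearMap.add_comp, LinearMap.comp_add]
  map_smul' c p := by
    funext i
    simp [LinearMap.smul_comp, LinearMap.comp_smul]
  invFun p := (LinearMap.pi fun i => (p i).1, ∑ i, (p i).2 ∘ₗ LinearMap.proj i)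
  left_inv p := by
    refine Prod.ext (LinearMap.ext fun x => rfl) (LinearMap.ext fun x => ?_)
    simp [LinearMap.sum_apply, ← map_sum, Finset.univ_sum_single]
  right_inv p := by
    funext i
    refine Prod.ext (LinearMap.ext fun x => rfl) (LinearMap.ext fun x => ?_)
    simp only [LinearMap.comp_apply, LinearMap.sum_apply, LinearMap.proj_apply,
      LinearMap.single_apply]
    rw [Finset.sum_eq_single i (fun j _ hj => by simp [hj]) (by simp)]
    simp

theorem pairsPiEquiv_mem_iff (p : (W →ₗ[ℝ] ∀ i, E i) × ((∀ i, E i) →ₗ[ℝ] W)) :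
    pairsPiEquiv W E p ∈ Submodule.pi Set.univ (fun i => adjointPairs H (P i)) ↔
      p ∈ adjointPairs H (piForm P) := by
  have hs : ∀ (i : ι) (z : ∀ i, E i) (u : E i),
      formBilin (piForm P) z (Pi.single i u) = formBilin (P i) (z i) u := by
    intro i z u
    rw [formBilin_piForm, Finset.sum_eq_single i (fun j _ hj => by simp [hj]) (by simp)]
    simp
  have hs' : ∀ (i : ι) (z : ∀ i, E i) (u : E i),
      formBilin (piForm P) (Pi.single i u) z = formBilin (P i) u (z i) := by
    intro i z u
    rw [formBilin_piForm, Finset.sum_eq_single i (fun j _ hj => by simp [hj]) (by simp)]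
    simp
  rw [Submodule.mem_pi, mem_adjointPairs]
  constructor
  · intro h x u
    rw [← Finset.univ_sum_single u]
    simp only [map_sum, LinearMap.sum_apply]
    refine ⟨Finset.sum_congr rfl fun i _ => ?_, Finset.sum_congr rfl fun i _ => ?_⟩
    · rw [hs]
      exact (h i trivial x (u i)).1
    · rw [hs']
      exact (h i trivial x (u i)).2
  · intro h i _ x u
    have := h x (Pi.single i u)
    rwa [hs, hs'] at this

theorem pairing_eq_sum_pairsPiEquiv (p q : (W →ₗ[ℝ] ∀ i, E i) × ((∀ i, E i) →ₗ[ℝ] W)) :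
    pairing p q = ∑ i, pairing (pairsPiEquiv W E p i) (pairsPiEquiv W E q i) := by
  refine LinearMap.ext fun x => ?_
  simp only [pairing, LinearMap.sum_apply, LinearMap.add_apply, Finset.sum_add_distrib]
  simp [pairsPiEquiv, ← map_sum, Finset.univ_sum_single]

theorem pairsPiEquiv_mem_radical_iff (p : (W →ₗ[ℝ] ∀ i, E i) × ((∀ i, E i) →ₗ[ℝ] W)) :
    pairsPiEquiv W E p ∈ Submodule.pi Set.univ (fun i => pairingRadical H (P i)) ↔
      p ∈ pairingRadical H (piForm P) := by
  rw [Submodule.mem_pi, mem_pairingRadical, ← pairsPiEquiv_mem_iff, Submodule.mem_pi]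
  constructor
  · intro h
    refine ⟨fun i _ => (h i trivial).1, fun q hq => ?_⟩
    rw [← pairsPiEquiv_mem_iff, Submodule.mem_pi] at hq
    rw [pairing_eq_sum_pairsPiEquiv]
    exact sum_mem fun i _ => (h i trivial).2 _ (hq i trivial)
  · intro h i _
    refine ⟨h.1 i trivial, fun q hq => ?_⟩
    have := h.2 ((pairsPiEquiv W E).symm (Pi.single i q)) (by
      rw [← pairsPiEquiv_mem_iff, LinearEquiv.apply_symm_apply, Submodule.mem_pi]
      intro j _
      rcases eq_or_ne j i with rfl | hj
      · simpa using hq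
      · simp [hj])
    rw [pairing_eq_sum_pairsPiEquiv, Finset.sum_eq_single i] at this
    · simpa using this
    · intro j _ hj
      simp [hj, pairing]
    · simp

omit [DecidableEq ι] in
theorem finrank_submodule_pi {M : ι → Type*} [∀ i, AddCommGroup (M i)] [∀ i, Module ℝ (M i)]
    [∀ i, FiniteDimensional ℝ (M i)] (p : ∀ i, Submodule ℝ (M i)) :
    Module.finrank ℝ (Submodule.pi Set.univ p) = ∑ i, Module.finrank ℝ (p i) := by
  rw [← Module.finrank_pi_fintype]
  exact LinearEquiv.finrank_eq
    { toFun := fun x i => ⟨x.1 i, x.2 i trivial⟩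
      map_add' := fun _ _ => rfl
      map_smul' := fun _ _ => rfl
      invFun := fun y => ⟨fun i => y i, fun i _ => (y i).2⟩
      left_inv := fun _ => rfl
      right_inv := fun _ => rfl }

theorem pairingRank_piForm [FiniteDimensional ℝ W] [∀ i, FiniteDimensional ℝ (E i)] :
    pairingRank H (piForm P) = ∑ i, pairingRank H (P i) := by
  unfold pairingRank
  rw [(pairsPiEquiv W E).finrank_eq_of_mem_iff (pairsPiEquiv_mem_iff (H := H) (P := P)),
    (pairsPiEquiv W E).finrank_eq_of_mem_iff (pairsPiEquiv_mem_radical_iff (H := H) (P := P)),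
    finrank_submodule_pi, finrank_submodule_pi]
  push_cast
  rw [Finset.sum_sub_distrib]

end Additivity

variable [FiniteDimensional ℝ W] [Nontrivial W]

omit [FiniteDimensional ℝ W] in
theorem FormIndecomposable.formSymmEquiv_of_isUnit_comp (hF : FormIndecomposable F)
    {p : (W →ₗ[ℝ] U) × (U →ₗ[ℝ] W)} (hp : p ∈ adjointPairs H F) (hu : IsUnit (p.2 ∘ₗ p.1)) :
    FormSymmEquiv H F := by
  obtain ⟨f, f'⟩ := p
  change IsUnit (f' ∘ₗ f) at hu
  let c : W ≃ₗ[ℝ] W := LinearMap.GeneralLinearGroup.generalLinearEquiv ℝ W hu.unit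
  have hc : ∀ x, f' (f x) = c x := fun x => rfl
  have hinj : Injective f := by
    intro x y hxy
    have := congrArg f' hxy
    rwa [hc, hc, c.injective.eq_iff] at this
  have hcompl : IsCompl (LinearMap.range f) (LinearMap.ker f') := by
    constructor
    · rw [Submodule.disjoint_def]
      rintro _ ⟨x, rfl⟩ hx
      rw [LinearMap.mem_ker, hc, c.map_eq_zero_iff] at hx
      rw [hx, map_zero]
    · rw [codisjoint_iff, eq_top_iff]
      intro u _
      rw [← add_sub_cancel (f (c.symm (f' u))) u]
      refine Submodule.add_mem_sup ⟨_, rfl⟩ ?_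
      rw [LinearMap.mem_ker, map_sub, hc, c.apply_symm_apply, sub_self]
  have hbot : LinearMap.ker f' = ⊥ := by
    refine (hF _ _ hcompl fun x k l hk hl => ?_).resolve_left fun h => ?_
    · obtain ⟨w, hw⟩ := hk
      rw [LinearMap.mem_ker] at hl
      rcases eq_or_ne k l with rfl | hkl
      · rw [← hw, hc, c.map_eq_zero_iff] at hl
        exact F.map_coord_zero k (by rw [← hw, hl, map_zero])
      · rw [form_eq_formBilin]
        obtain ⟨rfl, rfl⟩ | ⟨rfl, rfl⟩ : (k = 0 ∧ l = 1) ∨ (k = 1 ∧ l = 0) := by omega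
        · rw [← hw, (hp w (x 1)).1, hl, map_zero]
        · rw [← hw, (hp w (x 0)).2, hl, map_zero, LinearMap.zero_apply]
    · rw [LinearMap.range_eq_bot] at h
      obtain ⟨x, hx⟩ := exists_ne (0 : W)
      exact hx (hinj (by simp [h]))
  have hsurj : Surjective f := by
    rw [← LinearMap.range_eq_top]
    have := hcompl.sup_eq_top
    rwa [hbot, sup_bot_eq] at this
  let φ : W ≃ₗ[ℝ] U := LinearEquiv.ofBijective f ⟨hinj, hsurj⟩
  refine formSymmEquiv_iff_formBilin.2 ⟨φ, c.symm.trans φ, fun x y => ?_, fun x y => ?_⟩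
  · have := (hp x (f (c.symm y))).1
    rw [hc, c.apply_symm_apply] at this
    exact this.symm
  · have := (hp y (f (c.symm x))).2
    rw [hc, c.apply_symm_apply] at this
    exact this.symm

theorem FormIndecomposable.pairingRank_eq_zero (hH : FormIndecomposable H)
    (hF : FormIndecomposable F) (h : ¬ FormSymmEquiv H F) : pairingRank H F = 0 := by
  have hnil : ∀ p ∈ adjointPairs H F, p.2 ∘ₗ p.1 ∈ nilSelfAdjoint H := fun p hp =>
    have hsa := formSelfAdjoint_comp_of_mem hp
    hH.mem_nilSelfAdjoint.2 ⟨hsa, (hH.isNilpotent_or_isUnit hsa).resolve_right fun hu =>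
      h (hF.formSymmEquiv_of_isUnit_comp hp hu)⟩
  have : pairingRadical H F = adjointPairs H F := by
    refine le_antisymm (fun p hp => hp.1) fun p hp => ⟨hp, fun q hq => ?_⟩
    rw [pairing_polarization]
    exact sub_mem (sub_mem (hnil _ (add_mem hp hq)) (hnil _ hp)) (hnil _ hq)
  rw [pairingRank, this, sub_self]

theorem FormIndecomposable.pairingRank_self_ne_zero (hH : FormIndecomposable H) :
    pairingRank H H ≠ 0 := by
  have h1 : ((1, 1) : (W →ₗ[ℝ] W) × (W →ₗ[ℝ] W)) ∈ adjointPairs H H := fun x u => ⟨rfl, rfl⟩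
  have hlt : pairingRadical H H < adjointPairs H H := by
    refine lt_of_le_of_ne (fun p hp => hp.1) fun h => ?_
    have h2 : ((1, 1) : (W →ₗ[ℝ] W) × (W →ₗ[ℝ] W)) ∈ pairingRadical H H := h ▸ h1
    have h3 := (hH.mem_nilSelfAdjoint.1 (h2.2 _ h1)).2
    have h4 : pairing ((1, 1) : (W →ₗ[ℝ] W) × (W →ₗ[ℝ] W)) (1, 1) = (2 : ℝ) • 1 := by
      rw [two_smul]
      rfl
    rw [h4] at h3
    have h5 : IsUnit ((2 : ℝ) • (1 : W →ₗ[ℝ] W)) :=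
      isUnit_one.smul (Units.mk0 (2 : ℝ) two_ne_zero)
    exact h5.not_isNilpotent h3
  have := Submodule.finrank_lt_finrank_of_lt hlt
  rw [pairingRank]
  omega

open Classical in
theorem FormIndecomposable.pairingRank_piForm_eq_card_mul (hH : FormIndecomposable H)
    {ι : Type*} [Fintype ι] [DecidableEq ι] {E : ι → Type*}
    [∀ i, AddCommGroup (E i)] [∀ i, Module ℝ (E i)] [∀ i, FiniteDimensional ℝ (E i)]
    {P : ∀ i, MultilinearMap ℝ (fun _ : Fin 2 => E i) ℝ} (hP : ∀ i, FormIndecomposable (P i)) :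
    pairingRank H (piForm P) =
      Fintype.card {i // FormSymmEquiv H (P i)} * pairingRank H H := by
  have : ∀ i, pairingRank H (P i) = if FormSymmEquiv H (P i) then pairingRank H H else 0 := by
    intro i
    split_ifs with h
    · exact h.symm.pairingRank_eq
    · exact hH.pairingRank_eq_zero (hP i) h
  rw [pairingRank_piForm, Finset.sum_congr rfl fun i _ => this i, ← Finset.sum_filter,
    Finset.sum_const, Fintype.card_subtype, nsmul_eq_mul]

end Multiplicity

section Matching

variable {ι κ : Type*} [Fintype ι] [DecidableEq ι] [Fintype κ] [DecidableEq κ]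
  {E : ι → Type*} [∀ i, AddCommGroup (E i)] [∀ i, Module ℝ (E i)]
  [∀ i, FiniteDimensional ℝ (E i)] [∀ i, Nontrivial (E i)]
  {E' : κ → Type*} [∀ i, AddCommGroup (E' i)] [∀ i, Module ℝ (E' i)]
  [∀ i, FiniteDimensional ℝ (E' i)] [∀ i, Nontrivial (E' i)]
  {H : ∀ i, MultilinearMap ℝ (fun _ : Fin 2 => E i) ℝ}
  {H' : ∀ i, MultilinearMap ℝ (fun _ : Fin 2 => E' i) ℝ}

open Classical in
theorem exists_equiv_formSymmEquiv_of_two (hind : ∀ i, FormIndecomposable (H i))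
    (hind' : ∀ i, FormIndecomposable (H' i)) (h : FormSymmEquiv (piForm H) (piForm H')) :
    ∃ e : ι ≃ κ, ∀ i, FormSymmEquiv (H i) (H' (e i)) := by
  have hcard : ∀ a, Fintype.card {i // FormSymmEquiv (H a) (H i)} =
      Fintype.card {j // FormSymmEquiv (H a) (H' j)} := by
    intro a
    have := h.pairingRank_eq (H := H a)
    rw [(hind a).pairingRank_piForm_eq_card_mul hind,
      (hind a).pairingRank_piForm_eq_card_mul hind'] at this
    exact_mod_cast mul_right_cancel₀ (hind a).pairingRank_self_ne_zero this
  have hcard' : ∀ b, Fintype.card {i // FormSymmEquiv (H' b) (H i)} =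
      Fintype.card {j // FormSymmEquiv (H' b) (H' j)} := by
    intro b
    have := h.pairingRank_eq (H := H' b)
    rw [(hind' b).pairingRank_piForm_eq_card_mul hind,
      (hind' b).pairingRank_piForm_eq_card_mul hind'] at this
    exact_mod_cast mul_right_cancel₀ (hind' b).pairingRank_self_ne_zero this
  let f : ι → Set ι := fun a => {a' | FormSymmEquiv (H a') (H a)}
  let g : κ → Set ι := fun b => {a' | FormSymmEquiv (H a') (H' b)}
  have hf : ∀ a a', f a' = f a ↔ FormSymmEquiv (H a) (H a') := fun a a' => by
    refine ⟨fun h => ?_, fun h => Set.ext fun x => ⟨fun hx => ?_, fun hx => ?_⟩⟩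
    · have : a ∈ f a := FormSymmEquiv.refl _
      rwa [← h] at this
    · exact FormSymmEquiv.trans hx h.symm
    · exact FormSymmEquiv.trans hx h
  have hg : ∀ a b, g b = f a ↔ FormSymmEquiv (H a) (H' b) := fun a b => by
    refine ⟨fun h => ?_, fun h => Set.ext fun x => ⟨fun hx => ?_, fun hx => ?_⟩⟩
    · have : a ∈ f a := FormSymmEquiv.refl _
      rwa [← h] at this
    · exact FormSymmEquiv.trans hx h.symm
    · exact FormSymmEquiv.trans hx h
  have hfib : ∀ c, Nonempty ({a // f a = c} ≃ {b // g b = c}) := by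
    intro c
    by_cases hc : ∃ a, f a = c
    · obtain ⟨a, rfl⟩ := hc
      rw [← Fintype.card_eq]
      simp only [hf, hg]
      exact hcard a
    · have : IsEmpty {a // f a = c} := ⟨fun a => hc ⟨a, a.2⟩⟩
      have : IsEmpty {b // g b = c} := ⟨fun b => by
        have hpos : 0 < Fintype.card {j // FormSymmEquiv (H' b) (H' j)} :=
          Fintype.card_pos_iff.2 ⟨⟨b, .refl _⟩⟩
        rw [← hcard', Fintype.card_pos_iff] at hpos
        obtain ⟨a, ha⟩ := hpos
        exact hc ⟨a, ((hg a b).2 ha.symm).symm.trans b.2⟩⟩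
      exact ⟨Equiv.equivOfIsEmpty _ _⟩
  let e := fun c => (hfib c).some
  exact ⟨Equiv.ofFiberEquiv e, fun i => (hg i _).1 (Equiv.ofFiberEquiv_map e i)⟩

end Matching

section Decomposition

theorem IsDecompFamily.apply_sum {K : Type*} [Field K] {n : ℕ} (hn : n ≠ 0) {U : Type*}
    [AddCommGroup U] [Module K U] {F : MultilinearMap K (fun _ : Fin n => U) K} {ι : Type*}
    [Fintype ι] [DecidableEq ι] {W : ι → Submodule K U} (hW : IsDecompFamily F W)
    (z : Fin n → ι → U) (hz : ∀ k i, z k i ∈ W i) :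
    F (fun k => ∑ i, z k i) = ∑ i, F fun k => z k i := by
  rw [F.map_sum]
  symm
  refine Finset.sum_of_injOn (fun i _ => i)
    (fun i _ j _ hij => congrFun hij ⟨0, Nat.pos_of_ne_zero hn⟩) (fun i _ => Finset.mem_univ _)
    (fun f _ hf => ?_) fun i _ => rfl
  obtain ⟨k, l, hkl⟩ : ∃ k l, f k ≠ f l := by
    by_contra! hconst
    exact hf ⟨f ⟨0, Nat.pos_of_ne_zero hn⟩, by simp, funext fun k => hconst _ k⟩
  exact hW.2 _ k l _ _ hkl (hz k _) (hz l _)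

/-- A form decomposed as `F₁ ⊕ ⋯ ⊕ F_s ⊕ 0` is pulled back from the orthogonal direct sum of
`F₁, …, F_s` along a split surjection. -/
theorem IsDecompFamily.exists_retract_piForm {K : Type*} [Field K] {n : ℕ} (hn : n ≠ 0) {U : Type*}
    [AddCommGroup U] [Module K U] {F : MultilinearMap K (fun _ : Fin n => U) K} {ι : Type*}
    [Fintype ι] [DecidableEq ι] {Us : ι → Submodule K U} {U₀ : Submodule K U}
    (hF : IsDecompFamily F fun o : Option ι => o.elim U₀ Us)
    (hF0 : ∀ x : Fin n → U, (∀ k, x k ∈ U₀) → F x = 0) :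
    ∃ (p : U →ₗ[K] ∀ i, Us i) (j : (∀ i, Us i) →ₗ[K] U), (∀ y, p (j y) = y) ∧
      ∀ u, F u = piForm (fun i => formRestrict F (Us i)) fun k => p (u k) := by
  let W : Option ι → Submodule K U := fun o => o.elim U₀ Us
  let D : DirectSum (Option ι) (fun o => W o) ≃ₗ[K] U :=
    LinearEquiv.ofBijective (DirectSum.coeLinearMap W) hF.1
  let p : U →ₗ[K] ∀ i, Us i := LinearMap.pi fun i =>
    DirectSum.component K (Option ι) (fun o => W o) (some i) ∘ₗ D.symm.toLinearMap
  refine ⟨p, ∑ i, (Us i).subtype ∘ₗ LinearMap.proj i, fun y => ?_, fun u => ?_⟩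
  · have hD : ∑ i, ((Us i).subtype ∘ₗ LinearMap.proj i) y =
        D (∑ i, DirectSum.lof K (Option ι) (fun o => W o) (some i) (y i)) := by
      rw [map_sum]
      refine Finset.sum_congr rfl fun i _ => ?_
      exact (DirectSum.coeLinearMap_lof W (some i) (y i)).symm
    funext i
    change DirectSum.component K (Option ι) (fun o => W o) (some i) (D.symm _) = y i
    rw [LinearMap.sum_apply, hD, D.symm_apply_apply, map_sum, Finset.sum_eq_single i]
    · exact DirectSum.component.lof_self K (M := fun o => W o) (some i) (y i)
    · intro j _ hj
      exact (DirectSum.component.of K (M := fun o => W o) (some i) (some j) (y j)).trans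
        (dif_neg (by simpa using hj))
    · simp
  · classical
    have hu : ∀ k, u k = ∑ o, (D.symm (u k) o : U) := by
      intro k
      conv_lhs => rw [← D.apply_symm_apply (u k)]
      exact DirectSum.coeLinearMap_eq_dfinsuppSum W _ |>.trans
        (DFinsupp.sum_eq_sum_fintype _ (by simp))
    have hW : IsDecompFamily F W := hF
    conv_lhs => rw [funext hu]
    rw [hW.apply_sum hn (fun k o => (D.symm (u k) o : U)) fun k o => (D.symm (u k) o).2,
      Fintype.sum_option, hF0 _ fun k => (D.symm (u k) none).2, zero_add, piForm_apply]
    rfl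

end Decomposition

end

/-- Theorem (b): if two real multilinear forms are symmetrically equivalent and each is
decomposed as a direct sum of nonzero indecomposable forms plus a zero form, then the numbers
of summands agree and, after reindexing, corresponding summands are congruent up to sign. -/
theorem stmt_1 {n : ℕ} (hn : 2 ≤ n) {U V : Type*}
    [AddCommGroup U] [Module ℝ U] [FiniteDimensional ℝ U]
    [AddCommGroup V] [Module ℝ V] [FiniteDimensional ℝ V]
    (F : MultilinearMap ℝ (fun _ : Fin n => U) ℝ)
    (G : MultilinearMap ℝ (fun _ : Fin n => V) ℝ)
    (h : FormSymmEquiv F G)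
    {s r : ℕ} (Us : Fin s → Submodule ℝ U) (U₀ : Submodule ℝ U)
    (Vs : Fin r → Submodule ℝ V) (V₀ : Submodule ℝ V)
    -- F = F₁ ⊕ ⋯ ⊕ F_s ⊕ 0
    (hFdec : IsDecompFamily F (fun o : Option (Fin s) => o.elim U₀ Us))
    (hF0 : ∀ x : Fin n → U, (∀ k, x k ∈ U₀) → F x = 0)
    (hFnz : ∀ i, formRestrict F (Us i) ≠ 0)
    (hFind : ∀ i, FormIndecomposable (formRestrict F (Us i)))
    -- G = G₁ ⊕ ⋯ ⊕ G_r ⊕ 0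
    (hGdec : IsDecompFamily G (fun o : Option (Fin r) => o.elim V₀ Vs))
    (hG0 : ∀ x : Fin n → V, (∀ k, x k ∈ V₀) → G x = 0)
    (hGnz : ∀ j, formRestrict G (Vs j) ≠ 0)
    (hGind : ∀ j, FormIndecomposable (formRestrict G (Vs j))) :
    s = r ∧ ∃ e : Fin s ≃ Fin r, ∀ i,
      FormCongruent (formRestrict F (Us i)) (formRestrict G (Vs (e i))) ∨
      FormCongruent (formRestrict F (Us i)) (-(formRestrict G (Vs (e i)))) := by
  have hn0 : n ≠ 0 := by omega
  have hFnd := fun i => (hFind i).nondegenerate hn0 (hFnz i)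
  have hGnd := fun j => (hGind j).nondegenerate hn0 (hGnz j)
  have := fun i => nontrivial_of_form_ne_zero hn0 (hFnz i)
  have := fun j => nontrivial_of_form_ne_zero hn0 (hGnz j)
  obtain ⟨p, i, hpi, hFp⟩ := hFdec.exists_retract_piForm hn0 hF0
  obtain ⟨q, j, hqj, hGq⟩ := hGdec.exists_retract_piForm hn0 hG0
  have hequiv := h.of_retract (piForm_nondegenerate hn hFnd) (piForm_nondegenerate hn hGnd)
    p i hpi hFp q j hqj hGq
  obtain ⟨e, he⟩ : ∃ e : Fin s ≃ Fin r, ∀ i,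
      FormSymmEquiv (formRestrict F (Us i)) (formRestrict G (Vs (e i))) := by
    obtain rfl | hn3 := hn.eq_or_lt
    · exact exists_equiv_formSymmEquiv_of_two hFind hGind hequiv
    · exact exists_equiv_formSymmEquiv_of_three_le hn3 hFnd hFind hGnd hGind hequiv
  exact ⟨by simpa using Fintype.card_congr e, e, fun i =>
    (he i).congruent_or_neg hn0 (hGind (e i))⟩
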